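/- Let (P_n)_{n≥0} be a monic OPS with respect to a regular functional u, set ω₀ = ω/(1−q) and π₂(x) = (x − ω₀ − r)(x − ω₀ − s) for some r, s ∈ ℂ, and suppose that for complex numbers c_{n,n+1} and c_{n,n} with c_{n,n} ≠ 0 the structure relation π₂(x)(D_{q,ω} P_{n+1})(x) = [n+1]_q ( P_{n+2}(x) + c_{n,n+1} P_{n+1}(x) + c_{n,n} P_n(x) ) holds for all n ≥ 0. Then with α := −q(γ₁ + π₂(β₀))/γ₁ and β := −α(β₀ − ω₀), one has α ≠ 0 and the functional u satisfies D_{1/q,−ω/q}( π₂·u ) = ( α(x − ω₀) + β )·u. -/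

import Mathlib

open Polynomial Finset

noncomputable section

namespace DiscreteCoherent

/-- The Hahn operator `D_{q,ω}` acting on polynomials:
`(D_{q,ω} f)(x) = (f(qx+ω) − f(x))/((q−1)x+ω)`.
Since `(q−1)x+ω = (q−1)(x − ω/(1−q))`, the (exact) division is performed
via division by the monic polynomial `X − C (ω/(1−q))`. -/
def hahnD (q ω : ℂ) (f : Polynomial ℂ) : Polynomial ℂ :=
  (q - 1)⁻¹ • ((f.comp (C q * X + C ω) - f) /ₘ (X - C (ω / (1 - q))))

/-- The shift operator `L_{q,ω}` on polynomials: `(L_{q,ω} f)(x) = f(qx+ω)`. -/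
def shiftL (q ω : ℂ) (f : Polynomial ℂ) : Polynomial ℂ := f.comp (C q * X + C ω)

/-- Functionals on complex polynomials (linearity is assumed separately). -/
abbrev PolyFun := Polynomial ℂ → ℂ

/-- Left multiplication of a functional by a polynomial: `⟨g·u, f⟩ = ⟨u, g f⟩`. -/
def pmul (g : Polynomial ℂ) (u : PolyFun) : PolyFun := fun f => u (g * f)

/-- The operator `D_{q,ω}` on functionals: `⟨D_{q,ω} u, f⟩ = −q⁻¹ ⟨u, D_{1/q,−ω/q} f⟩`. -/
def fD (q ω : ℂ) (u : PolyFun) : PolyFun := fun f => -q⁻¹ * u (hahnD q⁻¹ (-ω / q) f)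

/-- The operator `L_{q,ω}` on functionals: `⟨L_{q,ω} u, f⟩ = ⟨u, L_{1/q,−ω/q} f⟩`. -/
def fL (q ω : ℂ) (u : PolyFun) : PolyFun := fun f => u (shiftL q⁻¹ (-ω / q) f)

/-- `[n]_q = (q^n − 1)/(q − 1)`. -/
def qNum (q : ℂ) (n : ℕ) : ℂ := (q ^ n - 1) / (q - 1)

/-- `[n]_q! = ∏_{j=1}^n [j]_q`. -/
def qFact (q : ℂ) (n : ℕ) : ℂ := ∏ j ∈ Finset.range n, qNum q (j + 1)

/-- The Gaussian binomial coefficient `[n choose k]_q`. -/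
def qBinom (q : ℂ) (n k : ℕ) : ℂ := qFact q n / (qFact q k * qFact q (n - k))

/-- `(P_n)` is the monic OPS with respect to the (regular) linear functional `u`. -/
structure IsMonicOPS (u : PolyFun) (P : ℕ → Polynomial ℂ) : Prop where
  lin : IsLinearMap ℂ u
  monic : ∀ n, (P n).Monic
  natDegree_eq : ∀ n, (P n).natDegree = n
  orth : ∀ m n, m ≠ n → u (P m * P n) = 0
  sq_ne : ∀ n, u (P n ^ 2) ≠ 0

/-- A linear functional is regular if it admits a monic OPS. -/
def IsRegular (u : PolyFun) : Prop := ∃ P, IsMonicOPS u P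

/-- The normalized discrete derivatives `P_n^{[m]} = ([n]_q!/[n+m]_q!) D_{q,ω}^m P_{n+m}`. -/
def dps (q ω : ℂ) (P : ℕ → Polynomial ℂ) (m n : ℕ) : Polynomial ℂ :=
  (qFact q n / qFact q (n + m)) • ((hahnD q ω)^[m] (P (n + m)))

/-- `((P_n),(Q_n))` is a `π_N`-`(q,ω)`-coherent pair with index `M` and order `(m,k)`,
with coefficients `c`.  The convention `Q_j ≡ 0` for `j < 0` is realized by the
truncated subtraction `n - M` in the lower summation limit. -/
structure IsCoherentPair (q ω : ℂ) (P Q : ℕ → Polynomial ℂ) (piN : Polynomial ℂ)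
    (M N m k : ℕ) (c : ℕ → ℕ → ℂ) : Prop where
  monic_pi : piN.Monic
  natDegree_pi : piN.natDegree = N
  struct : ∀ n, piN * dps q ω P m n =
    ∑ j ∈ Finset.Icc (n - M) (n + N), c n j • dps q ω Q k j
  lead : ∀ n, c n (n + N) = 1
  coeff_ne : ∀ n, M ≤ n → c n (n - M) ≠ 0

/-- The polynomial `ψ(·;n)`; terms with negative indices are omitted (truncated
subtraction in the lower summation limit). -/
def psiP (q : ℂ) (u : PolyFun) (P : ℕ → Polynomial ℂ) (c : ℕ → ℕ → ℂ)
    (M N m : ℕ) (n : ℕ) : Polynomial ℂ :=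
  ∑ j ∈ Finset.Icc (n - N) (n + M),
    ((-q) ^ m * qFact q (j + m) / (qFact q j * u (P (m + j) ^ 2)) * c j n) • P (m + j)

/-- The polynomial `φ(·;n,j)`. -/
def phiP (q ω : ℂ) (v : PolyFun) (Q : ℕ → Polynomial ℂ) (piN : Polynomial ℂ)
    (N k : ℕ) (n j : ℕ) : Polynomial ℂ :=
  ((-q) ^ k * qFact q (n + k) / (qFact q n * v (Q (n + k) ^ 2))) •
    ∑ l ∈ Finset.range (N - j + 1),
      (qBinom q⁻¹ (k + n) l * qBinom q⁻¹ (N - l) (N - j - l)) •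
        ((shiftL q⁻¹ (-ω / q))^[k + N - l] ((hahnD q⁻¹ (-ω / q))^[l] piN) *
          (shiftL q⁻¹ (-ω / q))^[j] ((hahnD q⁻¹ (-ω / q))^[n - j - l] (Q (n + k))))

/-- `u` is a `D_{q,ω}`-semiclassical functional. -/
def IsSemiclassical (q ω : ℂ) (u : PolyFun) : Prop :=
  ∃ phi psi : Polynomial ℂ, phi ≠ 0 ∧ psi ≠ 0 ∧ 1 ≤ psi.natDegree ∧
    fD q ω (pmul phi u) = pmul psi u

/-- The class `s(u)` of a `D_{q,ω}`-semiclassical functional. -/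
def semiClass (q ω : ℂ) (u : PolyFun) : ℕ :=
  sInf {s | ∃ phi psi : Polynomial ℂ, phi ≠ 0 ∧ psi ≠ 0 ∧ 1 ≤ psi.natDegree ∧
    fD q ω (pmul phi u) = pmul psi u ∧
    max (phi.natDegree - 2) (psi.natDegree - 1) = s}

end DiscreteCoherent
namespace DiscreteCoherent

theorem add_divByMonic {R : Type*} [CommRing R] {p : R[X]} (hp : p.Monic) (f g : R[X]) :
    (f + g) /ₘ p = f /ₘ p + g /ₘ p := by
  nontriviality R
  refine (div_modByMonic_unique _ (f %ₘ p + g %ₘ p) hp ⟨?_, ?_⟩).1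
  · linear_combination modByMonic_add_div f p + modByMonic_add_div g p
  · rw [← add_modByMonic]
    exact degree_modByMonic_lt _ hp

theorem smul_divByMonic {R : Type*} [CommRing R] {p : R[X]} (hp : p.Monic) (a : R) (f : R[X]) :
    (a • f) /ₘ p = a • (f /ₘ p) := by
  nontriviality R
  refine (div_modByMonic_unique _ (a • (f %ₘ p)) hp ⟨?_, ?_⟩).1
  · rw [mul_smul_comm, ← smul_add, modByMonic_add_div]
  · rw [← smul_modByMonic]
    exact degree_modByMonic_lt _ hp

/-- The Hahn operator as a linear map. -/
def hahnLinear (q ω : ℂ) : Polynomial ℂ →ₗ[ℂ] Polynomial ℂ where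
  toFun := hahnD q ω
  map_add' f g := by
    simp only [hahnD, add_comp, add_sub_add_comm, add_divByMonic (monic_X_sub_C _), smul_add]
  map_smul' a f := by
    simp only [hahnD, smul_comp, ← smul_sub, smul_divByMonic (monic_X_sub_C _),
      RingHom.id_apply]
    rw [smul_comm]

theorem hahnD_C (q ω a : ℂ) : hahnD q ω (C a) = 0 := by
  simp [hahnD]

theorem hahnD_X_sub_C (q ω a : ℂ) (hq : q ≠ 1) : hahnD q ω (X - C a) = 1 := by
  have h1 : q - 1 ≠ 0 := sub_ne_zero.mpr hq
  have h2 : 1 - q ≠ 0 := sub_ne_zero.mpr hq.symm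
  have key : (X - C a).comp (C q * X + C ω) - (X - C a)
      = (X - C (ω / (1 - q))) * C (q - 1) := by
    have hω : C ω = C (ω / (1 - q)) * C (1 - q) := by
      rw [← C_mul, div_mul_cancel₀ _ h2]
    simp only [sub_comp, X_comp, C_comp]
    rw [hω]
    simp only [C_sub, C_1]
    ring
  rw [hahnD, key, mul_divByMonic_cancel_left _ (monic_X_sub_C _), smul_C, smul_eq_mul,
    inv_mul_cancel₀ h1, C_1]

/-- Linear functionals that agree on a monic OPS are equal. -/
theorem IsMonicOPS.linearMap_ext {u : PolyFun} {P : ℕ → Polynomial ℂ} (hu : IsMonicOPS u P)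
    {f g : Polynomial ℂ →ₗ[ℂ] ℂ} (h : ∀ n, f (P n) = g (P n)) : f = g := by
  let S : Polynomial.Sequence ℂ :=
    { elems' := P
      degree_eq' := fun n => by
        rw [degree_eq_natDegree (hu.monic n).ne_zero, hu.natDegree_eq] }
  have hspan : Submodule.span ℂ (Set.range P) = ⊤ :=
    S.span fun n => by
      change IsUnit (P n).leadingCoeff
      rw [(hu.monic n).leadingCoeff]
      exact isUnit_one
  exact LinearMap.ext_on_range hspan h

theorem IsMonicOPS.zero_eq_one {u : PolyFun} {P : ℕ → Polynomial ℂ} (hu : IsMonicOPS u P) :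
    P 0 = 1 :=
  (hu.monic 0).natDegree_eq_zero.mp (hu.natDegree_eq 0)

theorem IsMonicOPS.apply_succ {u : PolyFun} {P : ℕ → Polynomial ℂ} (hu : IsMonicOPS u P)
    (n : ℕ) : u (P (n + 1)) = 0 := by
  simpa [hu.zero_eq_one] using hu.orth (n + 1) 0 (by omega)

/-- **Case N = 2 of Theorem 3.1 (functional equation).** If
`π₂(x) D_{q,ω}P_{n+1} = [n+1]_q (P_{n+2} + c_{n,n+1}P_{n+1} + c_{n,n}P_n)` with
`c_{n,n} ≠ 0` and `π₂(x) = (x − ω₀ − r)(x − ω₀ − s)`, then, with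
`α = −q(γ₁ + π₂(β₀))/γ₁` and `β = −α(β₀ − ω₀)`, one has `α ≠ 0` and
`D_{1/q,−ω/q}(π₂·u) = (α(x − ω₀) + β)·u`. -/
theorem case_N_two_functional_equation (q ω : ℂ) (hq0 : q ≠ 0)
    (hq : ∀ n : ℕ, 1 ≤ n → q ^ n ≠ 1)
    (u : PolyFun) (P : ℕ → Polynomial ℂ) (hu : IsMonicOPS u P)
    (β γ : ℕ → ℂ) (hγ : ∀ n, 1 ≤ n → γ n ≠ 0)
    (hrec0 : X * P 0 = P 1 + C (β 0) * P 0)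
    (hrec : ∀ n, X * P (n + 1) = P (n + 2) + C (β (n + 1)) * P (n + 1) + C (γ (n + 1)) * P n)
    (ω₀ : ℂ) (hω₀ : ω₀ = ω / (1 - q))
    (r s : ℂ) (π₂ : Polynomial ℂ) (hπ₂ : π₂ = (X - C (ω₀ + r)) * (X - C (ω₀ + s)))
    (cn1 cn0 : ℕ → ℂ) (hcn0 : ∀ n, cn0 n ≠ 0)
    (hrel : ∀ n, π₂ * hahnD q ω (P (n + 1)) =
      qNum q (n + 1) • (P (n + 2) + cn1 n • P (n + 1) + cn0 n • P n))
    (α βc : ℂ) (hα : α = -q * (γ 1 + π₂.eval (β 0)) / γ 1)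
    (hβc : βc = -α * (β 0 - ω₀)) :
    α ≠ 0 ∧
    fD q⁻¹ (-ω / q) (pmul π₂ u) = pmul (C α * (X - C ω₀) + C βc) u := by
  have hq1 : q ≠ 1 := by simpa using hq 1 le_rfl
  have hγ1 := hγ 1 le_rfl
  have hP0 := hu.zero_eq_one
  have hP1 : P 1 = X - C (β 0) := by
    rw [hP0] at hrec0
    linear_combination -hrec0
  have hqNum : qNum q 1 = 1 := by
    simp [qNum, div_self (sub_ne_zero.mpr hq1)]
  have hc : cn0 0 = γ 1 + π₂.eval (β 0) := by
    have h1 := congrArg (Polynomial.eval (β 0)) (hrel 0)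
    have h2 := congrArg (Polynomial.eval (β 0)) (hrec 0)
    simp only [zero_add, hP0, hP1, hqNum, hahnD_X_sub_C q ω _ hq1, eval_mul, eval_add, eval_sub,
      eval_X, eval_C, eval_one, eval_smul, smul_eq_mul] at h1 h2
    linear_combination -h1 + h2
  have hαγ : α * γ 1 = -q * cn0 0 := by
    rw [hα, hc, div_mul_cancel₀ _ hγ1]
  refine ⟨?_, ?_⟩
  · intro h
    rw [h, zero_mul] at hαγ
    exact mul_ne_zero (neg_ne_zero.mpr hq0) (hcn0 0) hαγ.symm
  have hψ : C α * (X - C ω₀) + C βc = α • P 1 := by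
    rw [hβc, hP1, smul_eq_C_mul]
    simp only [C_mul, C_neg, C_sub]
    ring
  let U : Polynomial ℂ →ₗ[ℂ] ℂ := hu.lin.mk' u
  have hU : ∀ f, U f = u f := fun _ => rfl
  have hsq : U (P 1 * P 1) = γ 1 * U 1 := by
    have h : P 1 * P 1 = P 2 + (β 1 - β 0) • P 1 + γ 1 • (1 : Polynomial ℂ) := by
      have h2 := hrec 0
      rw [hP0] at h2
      simp only [smul_eq_C_mul, C_sub, zero_add] at h2 ⊢
      linear_combination h2 + P 1 * hP1
    rw [h, map_add, map_add, map_smul, map_smul, hU, hU, hu.apply_succ 1, hu.apply_succ 0]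
    simp
  have hω : -(-ω / q) / q⁻¹ = ω := by field_simp
  have hext : (-q) • U ∘ₗ LinearMap.mulLeft ℂ π₂ ∘ₗ hahnLinear q ω
      = α • U ∘ₗ LinearMap.mulLeft ℂ (P 1) := by
    refine hu.linearMap_ext fun n => ?_
    change -q * U (π₂ * hahnD q ω (P n)) = α * U (P 1 * P n)
    rcases n with _ | n
    · have h0 : hahnD q ω (P 0) = 0 := by rw [hP0, ← C_1, hahnD_C]
      rw [h0, hU (P 1 * P 0), hu.orth 1 0 one_ne_zero]
      simp
    · rw [hrel, map_smul, map_add, map_add, map_smul, map_smul, hU (P (n + 2)), hU (P (n + 1)),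
        hu.apply_succ (n + 1), hu.apply_succ n]
      rcases n with _ | n
      · rw [zero_add, hqNum, hsq, hP0]
        simp only [smul_eq_mul]
        linear_combination -(U 1) * hαγ
      · rw [hU (P (n + 1)), hu.apply_succ n, hU, hu.orth 1 (n + 1 + 1) (by omega)]
        simp
  funext f
  have h := LinearMap.congr_fun hext f
  rw [hψ]
  simp only [fD, pmul, inv_inv, hω, smul_mul_assoc]
  rw [← hU (α • (P 1 * f)), map_smul]
  exact h

end DiscreteCoherent
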